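/- arXiv:0809.4036 — 7 statements merged into one kernel-verified Lean document; each statement's English description precedes it below -/
import Mathlib

section
/- Let r be a positive natural number and let R be a commutative integral domain graded by ℤ^r such that the degree-zero subring R_0 is Noetherian. If there exists m = (m_1,…,m_r) ∈ (ℤ_{>0})^r such that the subring R^(m) is a finitely generated R_0-algebra, then R itself is a finitely generated R_0-algebra. -/
/-- For a ring `R` graded by `ℤ^r` via `𝒜` and `m ∈ ℤ^r`, the additive subgroup
`R^(m) = ⊕_{a ∈ ℤ^r} R_{(a₁m₁,…,aᵣmᵣ)}`, i.e. the sum of all graded pieces `𝒜 d`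
whose degree `d` satisfies `mᵢ ∣ dᵢ` for every `i`. -/
def veroneseSubgroup {r : ℕ} {R : Type*} [CommRing R]
    (𝒜 : (Fin r → ℤ) → AddSubgroup R) (m : Fin r → ℤ) : AddSubgroup R :=
  ⨆ a : Fin r → ℤ, 𝒜 (fun i => a i * m i)

/-- If `R` is a `ℤ^r`-graded integral domain with Noetherian degree-zero subring `R₀`,
and `R^(m)` is a finitely generated `R₀`-algebra for some `m ∈ (ℤ_{>0})^r`,
then `R` is a finitely generated `R₀`-algebra. -/
theorem stmt_0 {r : ℕ} (hr : 0 < r) {R : Type*} [CommRing R] [IsDomain R]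
    (𝒜 : (Fin r → ℤ) → AddSubgroup R) [GradedRing 𝒜]
    (R0 : Subring R) (hR0 : (R0 : Set R) = 𝒜 (0 : Fin r → ℤ))
    (hNoeth : IsNoetherianRing R0)
    (hfg : ∃ m : Fin r → ℤ, (∀ i, 0 < m i) ∧
        ∃ s : Finset R, (↑s : Set R) ⊆ veroneseSubgroup 𝒜 m ∧
          ∀ x : R, x ∈ veroneseSubgroup 𝒜 m ↔ x ∈ Algebra.adjoin R0 (↑s : Set R)) :
    ∃ s : Finset R, Algebra.adjoin R0 (↑s : Set R) = ⊤ := by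
  classical
  obtain ⟨m, hm, s, -, hs⟩ := hfg
  set S : Subalgebra R0 R := Algebra.adjoin R0 (↑s : Set R) with hS
  have hft : Algebra.FiniteType R0 S := Subalgebra.fg_iff_finiteType S |>.1 ⟨s, rfl⟩
  have hSN : IsNoetherianRing S := Algebra.FiniteType.isNoetherianRing R0 S
  have hmemS : ∀ (a : Fin r → ℤ) (x : R), x ∈ 𝒜 (fun i => a i * m i) → x ∈ S := by
    intro a x hx
    exact (hs x).1 ((le_iSup (fun a : Fin r → ℤ => 𝒜 (fun i => a i * m i)) a) hx)
  let M : (Fin r → ℤ) → Submodule S R := fun c =>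
    Submodule.span S (⋃ a : Fin r → ℤ, (𝒜 (c + fun i => a i * m i) : Set R))
  have hMfg : ∀ c, (M c).FG := by
    intro c
    by_cases h : ∃ (a : Fin r → ℤ) (f : R), f ∈ 𝒜 (c + fun i => a i * m i) ∧ f ≠ 0
    · obtain ⟨a, f, hf, hf0⟩ := h
      obtain ⟨k, hk⟩ : ∃ k : ℕ, ((k + 1 : ℕ) : ℤ) = ∏ i, m i := by
        have hpos : 0 < ∏ i, m i := Finset.prod_pos fun i _ => hm i
        exact ⟨(∏ i, m i).toNat - 1, by omega⟩
      have hdvd : ∀ i, m i ∣ ((k + 1 : ℕ) : ℤ) := fun i => by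
        rw [hk]; exact Finset.dvd_prod_of_mem m (Finset.mem_univ i)
      choose q hq using hdvd
      have hinj : Function.Injective (LinearMap.mulLeft S (f ^ k)) := by
        intro x y hxy
        exact mul_left_cancel₀ (pow_ne_zero k hf0) hxy
      refine Submodule.fg_of_fg_map_injective (LinearMap.mulLeft S (f ^ k)) hinj ?_
      have hN : IsNoetherian S (LinearMap.range (Algebra.linearMap S R)) := inferInstance
      have hle : (M c).map (LinearMap.mulLeft S (f ^ k)) ≤
          LinearMap.range (Algebra.linearMap S R) := by
        rw [Submodule.map_le_iff_le_comap, Submodule.span_le]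
        intro x hx
        obtain ⟨b, hb⟩ := Set.mem_iUnion.1 hx
        have h1 := SetLike.mul_mem_graded (SetLike.pow_mem_graded k hf) hb
        refine ⟨⟨f ^ k * x, hmemS (fun i => q i * c i + k * a i + b i) _ ?_⟩, rfl⟩
        convert h1 using 2
        funext i
        have := hq i
        push_cast at this
        simp only [Pi.add_apply, Pi.mul_apply, Pi.natCast_apply, nsmul_eq_mul]
        linear_combination (-c i) * this
      exact (isNoetherian_submodule.1 hN) _ hle
    · push Not at h
      have : M c = ⊥ := by
        rw [eq_bot_iff, Submodule.span_le]
        intro x hx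
        obtain ⟨b, hb⟩ := Set.mem_iUnion.1 hx
        exact h b x hb
      rw [this]
      exact Submodule.fg_bot
  have htop : (⨆ c ∈ Fintype.piFinset (fun i => Finset.Ico 0 (m i)), M c) = ⊤ := by
    rw [eq_top_iff]
    intro x _
    rw [← DirectSum.sum_support_decompose 𝒜 x]
    refine Submodule.sum_mem _ fun d _ => ?_
    have hc : (fun i => d i % m i) ∈ Fintype.piFinset (fun i => Finset.Ico 0 (m i)) := by
      rw [Fintype.mem_piFinset]
      intro i
      exact Finset.mem_Ico.2 ⟨Int.emod_nonneg _ (hm i).ne', Int.emod_lt_of_pos _ (hm i)⟩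
    refine (le_iSup₂_of_le (f := fun c (_ : c ∈ Fintype.piFinset
      (fun i => Finset.Ico 0 (m i))) => M c) _ hc le_rfl) (Submodule.subset_span ?_)
    refine Set.mem_iUnion.2 ⟨fun i => d i / m i, ?_⟩
    have hd : ((fun i => d i % m i) + fun i => d i / m i * m i) = d := by
      funext i
      exact Int.emod_add_ediv_mul (d i) (m i)
    rw [hd]
    exact SetLike.coe_mem _
  have hfin : Module.Finite S R := ⟨by
    rw [← htop]
    exact Submodule.fg_biSup _ _ fun c _ => hMfg c⟩
  have hfinal : Algebra.FiniteType R0 R := Algebra.FiniteType.trans hft inferInstance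
  exact hfinal.out
end

section
/- Let r be a positive natural number and let R be a commutative integral domain graded by ℤ^r such that the degree-zero subring R_0 is Noetherian. If R is a finitely generated R_0-algebra, then for every m = (m_1,…,m_r) ∈ (ℤ_{>0})^r, the subring R^(m) is a finitely generated R_0-algebra. -/
/-- If `R` is a `ℤ^r`-graded integral domain with Noetherian degree-zero subring `R₀`,
and `R` is a finitely generated `R₀`-algebra, then for every `m ∈ (ℤ_{>0})^r` the
subring `R^(m)` is a finitely generated `R₀`-algebra. -/
theorem stmt_1 {r : ℕ} (hr : 0 < r) {R : Type*} [CommRing R] [IsDomain R]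
    (𝒜 : (Fin r → ℤ) → AddSubgroup R) [GradedRing 𝒜]
    (R0 : Subring R) (hR0 : (R0 : Set R) = 𝒜 (0 : Fin r → ℤ))
    (hNoeth : IsNoetherianRing R0)
    (hfg : ∃ s : Finset R, Algebra.adjoin R0 (↑s : Set R) = ⊤)
    (m : Fin r → ℤ) (hm : ∀ i, 0 < m i) :
    ∃ s : Finset R, (↑s : Set R) ⊆ veroneseSubgroup 𝒜 m ∧
      ∀ x : R, x ∈ veroneseSubgroup 𝒜 m ↔ x ∈ Algebra.adjoin R0 (↑s : Set R) := by
  classical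
  have mem_of : ∀ (d : Fin r → ℤ) (x : R), x ∈ 𝒜 d → (∀ i, m i ∣ d i) →
      x ∈ veroneseSubgroup 𝒜 m := by
    intro d x hx hd
    choose a ha using hd
    have hda : d = fun i => a i * m i := by
      funext i
      rw [ha i, mul_comm]
    rw [hda] at hx
    exact (le_iSup (fun a : Fin r → ℤ => 𝒜 (fun i => a i * m i)) a) hx
  have zero_mem' : ∀ x ∈ 𝒜 0, x ∈ veroneseSubgroup 𝒜 m := fun x hx =>
    mem_of 0 x hx (fun i => by simp)
  have mul_mem' : ∀ x ∈ veroneseSubgroup 𝒜 m, ∀ y ∈ veroneseSubgroup 𝒜 m,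
      x * y ∈ veroneseSubgroup 𝒜 m := by
    intro x hx y hy
    refine AddSubgroup.iSup_induction (C := fun x => x * y ∈ veroneseSubgroup 𝒜 m) _ hx
      ?_ ?_ ?_
    · intro a x hx
      refine AddSubgroup.iSup_induction (C := fun y => x * y ∈ veroneseSubgroup 𝒜 m) _ hy
        ?_ ?_ ?_
      · intro b y hy
        refine mem_of _ _ (SetLike.mul_mem_graded hx hy) (fun i => ?_)
        exact dvd_add (dvd_mul_left _ _) (dvd_mul_left _ _)
      · simpa using zero_mem _
      · intro u v hu hv
        rw [mul_add]
        exact add_mem hu hv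
    · simpa using zero_mem _
    · intro u v hu hv
      rw [add_mul]
      exact add_mem hu hv
  let B : Subalgebra R0 R :=
    { carrier := veroneseSubgroup 𝒜 m
      mul_mem' := fun hx hy => mul_mem' _ hx _ hy
      add_mem' := fun hx hy => add_mem hx hy
      algebraMap_mem' := fun c => zero_mem' _ (by
        have h : (c : R) ∈ (R0 : Set R) := c.2
        rw [hR0] at h
        exact h) }
  have hB : ∀ x, x ∈ B ↔ x ∈ veroneseSubgroup 𝒜 m := fun x => Iff.rfl
  have hint : ∀ (d : Fin r → ℤ) (x : R), x ∈ 𝒜 d → IsIntegral B x := by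
    intro d x hx
    have hN : 0 < ∏ i, (m i).toNat := Finset.prod_pos (fun i _ => by have := hm i; omega)
    refine IsIntegral.of_pow hN ?_
    have hmem : x ^ (∏ i, (m i).toNat) ∈ B := by
      refine mem_of _ _ (SetLike.pow_mem_graded _ hx) (fun i => ?_)
      have h1 : (m i).toNat ∣ ∏ i, (m i).toNat := Finset.dvd_prod_of_mem _ (Finset.mem_univ i)
      have h2 : m i ∣ ((∏ i, (m i).toNat : ℕ) : ℤ) := by
        have h3 := Int.natCast_dvd_natCast.mpr h1
        rwa [Int.toNat_of_nonneg (hm i).le] at h3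
      rw [Pi.smul_apply, nsmul_eq_mul]
      exact h2.mul_right _
    exact isIntegral_algebraMap (R := B) (A := R) (x := ⟨_, hmem⟩)
  have hI : Algebra.IsIntegral B R := ⟨fun x => by
    rw [← DirectSum.sum_support_decompose 𝒜 x]
    exact IsIntegral.sum _ (fun d _ => hint d _ (SetLike.coe_mem _))⟩
  have hft : Algebra.FiniteType R0 R := ⟨hfg⟩
  have hft' : Algebra.FiniteType B R := Algebra.FiniteType.of_restrictScalars_finiteType R0 B R
  have hfin : Module.Finite B R := Algebra.IsIntegral.finite
  have key : (⊤ : Subalgebra R0 B).FG :=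
    fg_of_fg_of_fg R0 B R hft.out hfin.fg_top Subtype.val_injective
  obtain ⟨s, hs⟩ := B.fg_top.mp key
  refine ⟨s, fun x hx => ?_, fun x => ?_⟩
  · have : x ∈ B := hs ▸ Algebra.subset_adjoin hx
    exact this
  · rw [hs, hB]
end

section
/- Let r be a positive natural number and let R be a commutative integral domain graded by ℤ^r such that the degree-zero subring R_0 is Noetherian. If R is a finitely generated R_0-algebra, then for every m = (m_1,…,m_r) ∈ (ℤ_{>0})^r, R is a finitely generated module over the subring R^(m). -/
/-- The Veronese subgroup as a subring. -/
def veroneseSubringAux {r : ℕ} {R : Type*} [CommRing R]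
    (𝒜 : (Fin r → ℤ) → AddSubgroup R) [GradedRing 𝒜] (m : Fin r → ℤ) : Subring R where
  carrier := veroneseSubgroup 𝒜 m
  zero_mem' := (veroneseSubgroup 𝒜 m).zero_mem
  add_mem' := fun ha hb => (veroneseSubgroup 𝒜 m).add_mem ha hb
  neg_mem' := fun ha => (veroneseSubgroup 𝒜 m).neg_mem ha
  one_mem' := by
    refine AddSubgroup.mem_iSup_of_mem (S := fun a : Fin r → ℤ => 𝒜 (fun i => a i * m i)) 0 ?_
    have h : (fun i => (0 : Fin r → ℤ) i * m i) = 0 := by ext i; simp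
    simp only [h]
    exact SetLike.GradedOne.one_mem
  mul_mem' := by
    intro a b ha hb
    change a * b ∈ veroneseSubgroup 𝒜 m
    change a ∈ veroneseSubgroup 𝒜 m at ha
    change b ∈ veroneseSubgroup 𝒜 m at hb
    refine AddSubgroup.iSup_induction (fun a : Fin r → ℤ => 𝒜 (fun i => a i * m i))
      (C := fun a => a * b ∈ veroneseSubgroup 𝒜 m) ha ?_ ?_ ?_
    · intro d x hx
      refine AddSubgroup.iSup_induction (fun a : Fin r → ℤ => 𝒜 (fun i => a i * m i))
        (C := fun b => x * b ∈ veroneseSubgroup 𝒜 m) hb ?_ ?_ ?_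
      · intro e y hy
        refine AddSubgroup.mem_iSup_of_mem
          (S := fun a : Fin r → ℤ => 𝒜 (fun i => a i * m i)) (d + e) ?_
        have h : (fun i => (d + e) i * m i) = (fun i => d i * m i) + (fun i => e i * m i) := by
          ext i; simp [add_mul]
        simp only [h]
        exact SetLike.GradedMul.mul_mem hx hy
      · rw [mul_zero]; exact zero_mem _
      · intro y z hy hz
        rw [mul_add]; exact add_mem hy hz
    · rw [zero_mul]; exact zero_mem _
    · intro y z hy hz
      rw [add_mul]; exact add_mem hy hz

/-- If `R` is a `ℤ^r`-graded integral domain with Noetherian degree-zero subring `R₀`,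
and `R` is a finitely generated `R₀`-algebra, then for every `m ∈ (ℤ_{>0})^r`, `R` is
a finitely generated module over the subring `R^(m)`: there is a finite set `s ⊆ R`
such that every element of `R` is a sum of products `c * t` with `c ∈ R^(m)`, `t ∈ s`. -/
theorem stmt_2 {r : ℕ} (hr : 0 < r) {R : Type*} [CommRing R] [IsDomain R]
    (𝒜 : (Fin r → ℤ) → AddSubgroup R) [GradedRing 𝒜]
    (R0 : Subring R) (hR0 : (R0 : Set R) = 𝒜 (0 : Fin r → ℤ))
    (hNoeth : IsNoetherianRing R0)
    (hfg : ∃ s : Finset R, Algebra.adjoin R0 (↑s : Set R) = ⊤)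
    (m : Fin r → ℤ) (hm : ∀ i, 0 < m i) :
    ∃ s : Finset R, ∀ x : R,
      x ∈ AddSubgroup.closure {y : R | ∃ c ∈ veroneseSubgroup 𝒜 m, ∃ t ∈ s, y = c * t} := by
  classical
  let S := veroneseSubringAux 𝒜 m
  have hS : ∀ (d : Fin r → ℤ) (x : R), (∀ i, m i ∣ d i) → x ∈ 𝒜 d → x ∈ S := by
    intro d x hd hx
    choose a ha using hd
    refine AddSubgroup.mem_iSup_of_mem (S := fun a : Fin r → ℤ => 𝒜 (fun i => a i * m i)) a ?_
    have h : (fun i => a i * m i) = d := by ext i; rw [ha i, mul_comm]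
    simp only [h]
    exact hx
  have hR0S : ∀ x ∈ R0, x ∈ S := by
    intro x hx
    refine hS 0 x (fun i => dvd_zero _) ?_
    have : x ∈ (R0 : Set R) := hx
    rw [hR0] at this
    exact this
  have h_integral : Algebra.IsIntegral S R := by
    refine ⟨fun x => ?_⟩
    rw [← DirectSum.sum_support_decompose 𝒜 x]
    refine IsIntegral.sum _ (fun d _ => ?_)
    have hN : 0 < (∏ i, m i).toNat := by
      have := Finset.prod_pos (s := Finset.univ) (fun i _ => hm i)
      omega
    have hN' : (((∏ i, m i).toNat : ℕ) : ℤ) = ∏ i, m i :=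
      Int.toNat_of_nonneg (Finset.prod_pos (fun i _ => hm i)).le
    refine IsIntegral.of_pow hN ?_
    have hmem := SetLike.pow_mem_graded (A := 𝒜) (∏ i, m i).toNat
      (DirectSum.decompose 𝒜 x d).2
    have h2 := hS _ _ (fun i => ?_) hmem
    · exact isIntegral_algebraMap (R := S) (A := R) (x := ⟨_, h2⟩)
    · rw [Pi.smul_apply, nsmul_eq_mul, hN']
      exact Dvd.dvd.mul_right (Finset.dvd_prod_of_mem m (Finset.mem_univ i)) _
  have hft : Algebra.FiniteType S R := by
    obtain ⟨s, hs⟩ := hfg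
    refine ⟨⟨s, ?_⟩⟩
    rw [eq_top_iff]
    intro x _
    have hx : x ∈ Algebra.adjoin R0 (↑s : Set R) := by rw [hs]; trivial
    induction hx using Algebra.adjoin_induction with
    | mem x hx => exact Algebra.subset_adjoin hx
    | algebraMap c =>
      exact (Algebra.adjoin S (↑s : Set R)).algebraMap_mem ⟨c.1, hR0S _ c.2⟩
    | add x y _ _ hx hy => exact add_mem (hx trivial) (hy trivial)
    | mul x y _ _ hx hy => exact mul_mem (hx trivial) (hy trivial)
  have hfin : Module.Finite S R := Algebra.IsIntegral.finite
  obtain ⟨t, ht⟩ := hfin.fg_top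
  refine ⟨t, fun x => ?_⟩
  have hx : x ∈ Submodule.span S (↑t : Set R) := by rw [ht]; trivial
  rw [Submodule.mem_span_finset] at hx
  obtain ⟨f, _, rfl⟩ := hx
  refine sum_mem (fun a ha => AddSubgroup.subset_closure ?_)
  exact ⟨(f a).1, (f a).2, a, ha, rfl⟩
end

section
/- Let r be a positive natural number and let R be a commutative integral domain graded by ℤ^r such that the degree-zero subring R_0 is Noetherian. Let m = (m_1,…,m_r) ∈ (ℤ_{>0})^r be such that the subring R^(m) is a finitely generated R_0-algebra. Then for every b ∈ ℤ^r, the R^(m)-submodule R^{(m)+b} = ⊕_{a∈ℤ^r} R_{(a_1 m_1 + b_1, …, a_r m_r + b_r)} of R is a finitely generated R^(m)-module. -/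
/-- For `b ∈ ℤ^r`, the shifted additive subgroup
`R^{(m)+b} = ⊕_{a ∈ ℤ^r} R_{(a₁m₁+b₁,…,aᵣmᵣ+bᵣ)}`. -/
def veroneseShiftSubgroup {r : ℕ} {R : Type*} [CommRing R]
    (𝒜 : (Fin r → ℤ) → AddSubgroup R) (m b : Fin r → ℤ) : AddSubgroup R :=
  ⨆ a : Fin r → ℤ, 𝒜 (fun i => a i * m i + b i)

theorem vshift_mul {r : ℕ} {R : Type*} [CommRing R]
    (𝒜 : (Fin r → ℤ) → AddSubgroup R) [GradedRing 𝒜] (m b c : Fin r → ℤ) {x y : R}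
    (hx : x ∈ veroneseShiftSubgroup 𝒜 m b) (hy : y ∈ veroneseShiftSubgroup 𝒜 m c) :
    x * y ∈ veroneseShiftSubgroup 𝒜 m (b + c) := by
  unfold veroneseShiftSubgroup at hx hy
  induction hx using AddSubgroup.iSup_induction' with
  | h1 => rw [zero_mul]; exact zero_mem _
  | hadd u v _ _ hu hv => rw [add_mul]; exact add_mem hu hv
  | hp i u hu =>
    induction hy using AddSubgroup.iSup_induction' with
    | h1 => rw [mul_zero]; exact zero_mem _
    | hadd v w _ _ hv hw => rw [mul_add]; exact add_mem hv hw
    | hp j v hv =>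
      refine AddSubgroup.mem_iSup_of_mem (i + j) ?_
      have h := SetLike.mul_mem_graded hu hv
      convert h using 2
      funext k
      simp only [Pi.add_apply]
      ring

theorem vshift_eq {r : ℕ} {R : Type*} [CommRing R]
    (𝒜 : (Fin r → ℤ) → AddSubgroup R) (m b e : Fin r → ℤ) (h : ∀ i, b i = e i * m i) :
    veroneseShiftSubgroup 𝒜 m b = veroneseSubgroup 𝒜 m := by
  unfold veroneseShiftSubgroup veroneseSubgroup
  apply le_antisymm
  · refine iSup_le fun a => ?_
    have h2 : (fun i => a i * m i + b i) = fun i => (a + e) i * m i := by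
      funext i; simp only [Pi.add_apply, h]; ring
    rw [h2]
    exact le_iSup (fun a : Fin r → ℤ => 𝒜 (fun i => a i * m i)) (a + e)
  · refine iSup_le fun a => ?_
    have h2 : (fun i => a i * m i) = fun i => (a - e) i * m i + b i := by
      funext i; simp only [Pi.sub_apply, h]; ring
    rw [h2]
    exact le_iSup (fun a : Fin r → ℤ => 𝒜 (fun i => a i * m i + b i)) (a - e)

theorem vshift_pow {r : ℕ} {R : Type*} [CommRing R]
    (𝒜 : (Fin r → ℤ) → AddSubgroup R) [GradedRing 𝒜] (m b : Fin r → ℤ) {x y : R}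
    (hx : x ∈ veroneseShiftSubgroup 𝒜 m b) (hy : y ∈ veroneseShiftSubgroup 𝒜 m b) (n : ℕ) :
    x * y ^ n ∈ veroneseShiftSubgroup 𝒜 m ((n + 1) • b) := by
  induction n with
  | zero => simpa using hx
  | succ n ih =>
    rw [pow_succ, ← mul_assoc, succ_nsmul]
    exact vshift_mul 𝒜 m _ _ ih hy

/-- If `R` is a `ℤ^r`-graded integral domain with Noetherian degree-zero subring `R₀`,
and `m ∈ (ℤ_{>0})^r` is such that `R^(m)` is a finitely generated `R₀`-algebra, then for
every `b ∈ ℤ^r` the `R^(m)`-module `R^{(m)+b}` is finitely generated: there is a finite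
set `s ⊆ R^{(m)+b}` such that every element of `R^{(m)+b}` is a sum of products `c * t`
with `c ∈ R^(m)`, `t ∈ s`. -/
theorem stmt_3 {r : ℕ} (hr : 0 < r) {R : Type*} [CommRing R] [IsDomain R]
    (𝒜 : (Fin r → ℤ) → AddSubgroup R) [GradedRing 𝒜]
    (R0 : Subring R) (hR0 : (R0 : Set R) = 𝒜 (0 : Fin r → ℤ))
    (hNoeth : IsNoetherianRing R0)
    (m : Fin r → ℤ) (hm : ∀ i, 0 < m i)
    (hfg : ∃ s : Finset R, (↑s : Set R) ⊆ veroneseSubgroup 𝒜 m ∧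
        ∀ x : R, x ∈ veroneseSubgroup 𝒜 m ↔ x ∈ Algebra.adjoin R0 (↑s : Set R))
    (b : Fin r → ℤ) :
    ∃ s : Finset R, (↑s : Set R) ⊆ veroneseShiftSubgroup 𝒜 m b ∧
      ∀ x ∈ veroneseShiftSubgroup 𝒜 m b,
        x ∈ AddSubgroup.closure {y : R | ∃ c ∈ veroneseSubgroup 𝒜 m, ∃ t ∈ s, y = c * t} := by
  classical
  obtain ⟨s, -, hs⟩ := hfg
  by_cases hM : ∀ y ∈ veroneseShiftSubgroup 𝒜 m b, y = 0
  · refine ⟨∅, by simp, fun x hx => ?_⟩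
    rw [hM x hx]
    exact zero_mem _
  push Not at hM
  obtain ⟨y, hy, hy0⟩ := hM
  obtain ⟨n, hn⟩ : ∃ n : ℕ, ((n + 1 : ℕ) : ℤ) = ∏ i, m i := by
    have hpos : 0 < ∏ i, m i := Finset.prod_pos fun i _ => hm i
    exact ⟨(∏ i, m i).toNat - 1, by omega⟩
  have hmul : ∀ x ∈ veroneseShiftSubgroup 𝒜 m b, x * y ^ n ∈ veroneseSubgroup 𝒜 m := by
    intro x hx
    have h := vshift_pow 𝒜 m b hx hy n
    have hdvd : ∀ i, ∃ e : ℤ, ((n + 1) • b) i = e * m i := by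
      intro i
      obtain ⟨k, hk⟩ := Finset.dvd_prod_of_mem m (Finset.mem_univ i)
      refine ⟨k * b i, ?_⟩
      rw [Pi.smul_apply, nsmul_eq_mul, hn, hk]
      ring
    choose e he using hdvd
    rwa [vshift_eq 𝒜 m _ e he] at h
  let A := Algebra.adjoin R0 (↑s : Set R)
  haveI : Algebra.FiniteType R0 A :=
    (Subalgebra.fg_iff_finiteType _).1 (Subalgebra.fg_adjoin_finset s)
  haveI : IsNoetherianRing A := Algebra.FiniteType.isNoetherianRing R0 A
  let M : Submodule A R :=
    { carrier := veroneseShiftSubgroup 𝒜 m b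
      add_mem' := fun h1 h2 => add_mem h1 h2
      zero_mem' := zero_mem _
      smul_mem' := by
        intro c x hx
        have hc : (c : R) ∈ veroneseSubgroup 𝒜 m := (hs _).2 c.2
        rw [← vshift_eq 𝒜 m 0 0 (by simp)] at hc
        have h := vshift_mul 𝒜 m _ _ hc hx
        rw [zero_add] at h
        exact h }
  let f : R →ₗ[A] R := LinearMap.mulRight A (y ^ n)
  have hf : Function.Injective f := mul_left_injective₀ (pow_ne_zero n hy0)
  have hle : M.map f ≤ LinearMap.range (Algebra.linearMap A R) := by
    rintro _ ⟨x, hx, rfl⟩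
    exact ⟨⟨x * y ^ n, (hs _).1 (hmul x hx)⟩, rfl⟩
  haveI : IsNoetherian A (LinearMap.range (Algebra.linearMap A R)) := inferInstance
  haveI := isNoetherian_of_le hle
  have hfgmap : (M.map f).FG := (Submodule.fg_top _).1 (IsNoetherian.noetherian _)
  obtain ⟨t, ht⟩ := Submodule.fg_of_fg_map_injective f hf hfgmap
  refine ⟨t, fun x hx => ?_, fun x hx => ?_⟩
  · have : x ∈ M := ht ▸ Submodule.subset_span hx
    exact this
  · have hx' : x ∈ Submodule.span A (t : Set R) := by rw [ht]; exact hx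
    induction hx' using Submodule.closure_induction with
    | zero => exact zero_mem _
    | add u v hu hv h1 h2 =>
      exact add_mem (h1 (by have : u ∈ M := ht ▸ hu
                            exact this)) (h2 (by have : v ∈ M := ht ▸ hv
                                                 exact this))
    | smul_mem c u hu =>
      exact AddSubgroup.subset_closure ⟨c, (hs _).2 c.2, u, hu, rfl⟩
end

section
/- Let k be a field, V a nonempty finite set, and I a proper ideal of the polynomial ring k[x_v : v ∈ V] generated by squarefree monomials. Then the height of I equals the minimum, over all subsets A ⊆ V such that the monomial x^A = ∏_{v∈A} x_v does not lie in I, of the cardinality |V∖A| of the complement of A. -/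
/-- The height (codimension) of an ideal: the infimum of the heights of the prime ideals
containing it, where the height of a prime is its height in the poset of primes. -/
noncomputable def idealHeight {S : Type*} [CommRing S] (I : Ideal S) : ℕ∞ :=
  ⨅ (P : PrimeSpectrum S) (_ : I ≤ P.asIdeal), Order.height P

open MvPolynomial in
/-- Evaluation killing the variables in `S`. -/
noncomputable def killVars (k : Type*) [Field k] {V : Type*} [DecidableEq V] (S : Finset V) :
    MvPolynomial V k →ₐ[k] MvPolynomial V k :=
  aeval (fun v => if v ∈ S then 0 else X v)

open MvPolynomial in
lemma sub_killVars_mem {k : Type*} [Field k] {V : Type*} [DecidableEq V] (S : Finset V)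
    (P : Ideal (MvPolynomial V k)) (h : ∀ v ∈ S, (X v : MvPolynomial V k) ∈ P)
    (f : MvPolynomial V k) : f - killVars k S f ∈ P := by
  have : (Ideal.Quotient.mkₐ k P).comp (killVars k S) = Ideal.Quotient.mkₐ k P := by
    apply MvPolynomial.algHom_ext
    intro v
    by_cases hv : v ∈ S
    · simpa [killVars, hv] using (Ideal.Quotient.eq_zero_iff_mem.2 (h v hv)).symm
    · simp [killVars, hv]
  rw [← Ideal.Quotient.eq]
  exact (DFunLike.congr_fun this f).symm

open MvPolynomial in
/-- The prime generated by the variables in `S`. -/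
noncomputable def varPrime (k : Type*) [Field k] {V : Type*} [DecidableEq V] (S : Finset V) :
    PrimeSpectrum (MvPolynomial V k) :=
  ⟨RingHom.ker (killVars k S), RingHom.ker_isPrime _⟩

open MvPolynomial in
lemma X_mem_varPrime {k : Type*} [Field k] {V : Type*} [DecidableEq V] (S : Finset V) (v : V) :
    (X v : MvPolynomial V k) ∈ (varPrime k S).asIdeal ↔ v ∈ S := by
  by_cases hv : v ∈ S <;> simp [varPrime, RingHom.mem_ker, killVars, hv]

open MvPolynomial in
lemma varPrime_le {k : Type*} [Field k] {V : Type*} [DecidableEq V] (S : Finset V)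
    (P : Ideal (MvPolynomial V k)) (h : ∀ v ∈ S, (X v : MvPolynomial V k) ∈ P) :
    (varPrime k S).asIdeal ≤ P := by
  intro f hf
  have := sub_killVars_mem S P h f
  have h0 : killVars k S f = 0 := hf
  simpa [h0] using this

open MvPolynomial in
lemma le_height_varPrime {k : Type*} [Field k] {V : Type*} [DecidableEq V] (S : Finset V) :
    (S.card : ℕ∞) ≤ Order.height (varPrime k S) := by
  induction S using Finset.induction_on with
  | empty => simp
  | insert a s ha ih =>
    have hlt : varPrime k s < varPrime k (insert a s) := by
      refine lt_of_le_of_ne ?_ ?_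
      · exact varPrime_le s _ (fun v hv => (X_mem_varPrime _ v).2 (Finset.mem_insert_of_mem hv))
      · intro h
        exact ha ((X_mem_varPrime (k := k) s a).1
          (h ▸ (X_mem_varPrime _ a).2 (Finset.mem_insert_self a s)))
    rw [Finset.card_insert_of_notMem ha]
    push_cast
    exact (add_le_add_left ih 1).trans (Order.height_add_one_le hlt)

open MvPolynomial in
lemma height_varPrime_le {k : Type*} [Field k] {V : Type*} [Fintype V] [DecidableEq V]
    (S : Finset V) : Order.height (varPrime k S) ≤ (S.card : ℕ∞) := by
  classical
  have hsp : (varPrime k S).asIdeal =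
      Ideal.span ((S.image (X : V → MvPolynomial V k) : Finset _) : Set (MvPolynomial V k)) := by
    apply le_antisymm
    · exact varPrime_le S _ (fun v hv => Ideal.subset_span (by simpa using hv))
    · rw [Ideal.span_le]
      intro f hf
      simp only [Finset.coe_image, Set.mem_image, Finset.mem_coe] at hf
      obtain ⟨v, hv, rfl⟩ := hf
      exact (X_mem_varPrime S v).2 hv
  have hp := (varPrime k S).isPrime
  have h1 := Ideal.height_le_card_of_mem_minimalPrimes_span_finset
    (p := (varPrime k S).asIdeal) (s := S.image (X : V → MvPolynomial V k))
    (by rw [← hsp, Ideal.minimalPrimes_eq_subsingleton_self]; rfl)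
  rw [PrimeSpectrum.height_eq_orderHeight] at h1
  exact h1.trans (by exact_mod_cast Finset.card_image_le)

/-- Let `I` be a proper ideal of `k[x_v : v ∈ V]` (`V` a nonempty finite set) generated by
squarefree monomials. Then the height of `I` is the minimum of `|V∖A|` over all subsets
`A ⊆ V` whose monomial `x^A = ∏_{v∈A} x_v` does not lie in `I`. -/
theorem stmt_5 {k : Type*} [Field k] {V : Type*} [Fintype V] [DecidableEq V] [Nonempty V]
    (I : Ideal (MvPolynomial V k)) (hI : I ≠ ⊤)
    (hsq : ∃ G : Set (Finset V), I = Ideal.span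
      ((fun A : Finset V => ∏ v ∈ A, (MvPolynomial.X v : MvPolynomial V k)) '' G)) :
    idealHeight I =
      ⨅ (A : Finset V) (_ : (∏ v ∈ A, (MvPolynomial.X v : MvPolynomial V k)) ∉ I),
        (Aᶜ.card : ℕ∞) := by
  obtain ⟨G, hG⟩ := hsq
  unfold idealHeight
  apply le_antisymm
  · refine le_iInf₂ fun A hA => ?_
    refine (iInf₂_le (varPrime k Aᶜ) ?_).trans (height_varPrime_le _)
    conv_lhs => rw [hG]
    rw [Ideal.span_le]
    rintro _ ⟨B, hB, rfl⟩
    have hBI : (∏ v ∈ B, (MvPolynomial.X v : MvPolynomial V k)) ∈ I := by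
      rw [hG]
      exact Ideal.subset_span ⟨B, hB, rfl⟩
    have hBA : ¬ B ⊆ A := fun h =>
      hA (Ideal.mem_of_dvd I (Finset.prod_dvd_prod_of_subset _ _ _ h) hBI)
    obtain ⟨v, hvB, hvA⟩ := Finset.not_subset.1 hBA
    exact Ideal.mem_of_dvd _ (Finset.dvd_prod_of_mem _ hvB)
      ((X_mem_varPrime _ v).2 (Finset.mem_compl.2 hvA))
  · classical
    refine le_iInf₂ fun P hP => ?_
    let A : Finset V := Finset.univ.filter fun v => (MvPolynomial.X v : MvPolynomial V k) ∉ P.asIdeal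
    have hA : (∏ v ∈ A, (MvPolynomial.X v : MvPolynomial V k)) ∉ I := by
      intro h
      obtain ⟨v, hv, hvP⟩ := (P.isPrime.prod_mem_iff).1 (hP h)
      exact (Finset.mem_filter.1 hv).2 hvP
    refine (iInf₂_le A hA).trans ((le_height_varPrime (k := k) Aᶜ).trans (Order.height_mono ?_))
    refine varPrime_le _ P.asIdeal fun v hv => ?_
    by_contra hc
    exact Finset.mem_compl.1 hv (Finset.mem_filter.2 ⟨Finset.mem_univ v, hc⟩)
end

section
/- Let k be a field, V a finite set, and F a downward-closed family of subsets of V with V ∉ F. Let I(F) be the ideal of k[x_v : v ∈ V] generated by the squarefree monomials x^{V∖A} = ∏_{v ∈ V∖A} x_v for A ∈ F. Then the height of I(F) is at least 3 if and only if every subset A ⊆ V with |A| ≤ 2 belongs to F. (This is the combinatorial content of the statement: a simplicial projective toric variety has small unstable locus if and only if its fan is 2-neighborly.) -/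
open MvPolynomial in
theorem varIdeal_eq_ker {k : Type*} [Field k] {V : Type*} [DecidableEq V] (A : Finset V) :
    Ideal.span ((X : V → MvPolynomial V k) '' (A : Set V)) =
      RingHom.ker (aeval (fun v => if v ∈ A then 0 else X v) :
        MvPolynomial V k →ₐ[k] MvPolynomial V k) := by
  apply le_antisymm
  · rw [Ideal.span_le]
    rintro _ ⟨v, hv, rfl⟩
    have hv' : v ∈ A := by simpa using hv
    simp [RingHom.mem_ker, hv']
  · intro p hp
    set I := Ideal.span ((X : V → MvPolynomial V k) '' (A : Set V)) with hI
    have h : (Ideal.Quotient.mkₐ k I).comp (aeval (fun v => if v ∈ A then 0 else X v) :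
        MvPolynomial V k →ₐ[k] MvPolynomial V k) = Ideal.Quotient.mkₐ k I := by
      apply MvPolynomial.algHom_ext
      intro v
      by_cases hv : v ∈ A
      · have : Ideal.Quotient.mk I (X v) = 0 :=
          Ideal.Quotient.eq_zero_iff_mem.2 (Ideal.subset_span ⟨v, by simpa using hv, rfl⟩)
        simp [hv, this]
      · simp [hv]
    have h2 := DFunLike.congr_fun h p
    rw [RingHom.mem_ker] at hp
    rw [AlgHom.comp_apply, hp, map_zero] at h2
    exact Ideal.Quotient.eq_zero_iff_mem.1 h2.symm

open MvPolynomial in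
theorem varIdeal_isPrime {k : Type*} [Field k] {V : Type*} [DecidableEq V] (A : Finset V) :
    (Ideal.span ((X : V → MvPolynomial V k) '' (A : Set V))).IsPrime := by
  rw [varIdeal_eq_ker]
  exact RingHom.ker_isPrime _

open MvPolynomial in
theorem X_mem_varIdeal {k : Type*} [Field k] {V : Type*} [DecidableEq V] (A : Finset V) (v : V) :
    (X v : MvPolynomial V k) ∈ Ideal.span ((X : V → MvPolynomial V k) '' (A : Set V)) ↔
      v ∈ A := by
  constructor
  · intro h
    by_contra hv
    rw [varIdeal_eq_ker, RingHom.mem_ker] at h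
    simp [hv] at h
  · intro h
    exact Ideal.subset_span ⟨v, by simpa using h, rfl⟩

open MvPolynomial in
theorem card_le_height_varIdeal {k : Type*} [Field k] {V : Type*} [DecidableEq V]
    (A : Finset V) :
    (A.card : ℕ∞) ≤ (Ideal.span ((X : V → MvPolynomial V k) '' (A : Set V))).height := by
  induction A using Finset.induction_on with
  | empty => simp
  | insert a s ha ih =>
    have h1 := varIdeal_isPrime (k := k) s
    have h2 := varIdeal_isPrime (k := k) (insert a s)
    rw [Finset.card_insert_of_notMem ha]
    push_cast
    refine le_trans (add_le_add_left ih 1) ?_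
    have hlt : Ideal.span ((X : V → MvPolynomial V k) '' (s : Set V)) <
        Ideal.span ((X : V → MvPolynomial V k) '' ((insert a s : Finset V) : Set V)) := by
      refine lt_of_le_of_ne (Ideal.span_mono (Set.image_mono (by simp))) ?_
      intro h
      apply ha
      rw [← X_mem_varIdeal (k := k), h, X_mem_varIdeal]
      simp
    simpa using Ideal.height_add_one_le_of_lt_of_isPrime hlt

/-- Let `F` be a downward-closed family of subsets of a finite set `V` with `V ∉ F`, and
let `I(F)` be the ideal of `k[x_v : v ∈ V]` generated by the squarefree monomials
`x^{V∖A}` for `A ∈ F`. Then `height I(F) ≥ 3` iff every `A ⊆ V` with `|A| ≤ 2` is in `F`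
(i.e. the fan is `2`-neighborly: the small unstable locus condition). -/
theorem stmt_6 {k : Type*} [Field k] {V : Type*} [Fintype V] [DecidableEq V]
    (F : Set (Finset V))
    (hdc : ∀ A B : Finset V, B ∈ F → A ⊆ B → A ∈ F)
    (hV : (Finset.univ : Finset V) ∉ F) :
    3 ≤ idealHeight (Ideal.span ((fun B : Finset V =>
        ∏ v ∈ Bᶜ, (MvPolynomial.X v : MvPolynomial V k)) '' F)) ↔
      ∀ A : Finset V, A.card ≤ 2 → A ∈ F := by
  classical
  unfold idealHeight
  constructor
  · intro h A hA
    by_contra hAF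
    have hp := varIdeal_isPrime (k := k) A
    rw [le_iInf₂_iff] at h
    have h3 := h ⟨_, hp⟩ (by
      rw [Ideal.span_le]
      rintro _ ⟨B, hB, rfl⟩
      have : ¬ A ⊆ B := fun hAB => hAF (hdc A B hB hAB)
      obtain ⟨v, hvA, hvB⟩ := Finset.not_subset.1 this
      exact Ideal.mem_of_dvd _ (Finset.dvd_prod_of_mem _ (by simpa using hvB))
        ((X_mem_varIdeal A v).2 hvA))
    rw [← PrimeSpectrum.height_eq_orderHeight] at h3
    have h4 := Ideal.height_le_card_of_mem_minimalPrimes_span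
      (s := (MvPolynomial.X : V → MvPolynomial V k) '' (A : Set V))
      (A.finite_toSet.image _) (by
        rw [Ideal.minimalPrimes_eq_subsingleton_self]; rfl)
    have h5 := Set.ncard_image_le (f := (MvPolynomial.X : V → MvPolynomial V k)) A.finite_toSet
    rw [Set.ncard_coe_finset] at h5
    have h6 := h3.trans h4
    have h7 : 3 ≤ ((MvPolynomial.X : V → MvPolynomial V k) '' (A : Set V)).ncard := by exact_mod_cast h6
    omega
  · intro h
    rw [le_iInf₂_iff]
    intro P hP
    set A : Finset V := Finset.univ.filter
      (fun v => (MvPolynomial.X v : MvPolynomial V k) ∈ P.asIdeal) with hAdef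
    have hA : 3 ≤ A.card := by
      by_contra hlt
      have hAF := h A (by omega)
      have hmem := hP (Ideal.subset_span ⟨A, hAF, rfl⟩)
      obtain ⟨v, hv, hvP⟩ := (P.isPrime.prod_mem_iff).1 hmem
      simp [hAdef] at hv
      exact hv hvP
    rw [← PrimeSpectrum.height_eq_orderHeight]
    calc (3 : ℕ∞) ≤ (A.card : ℕ∞) := by exact_mod_cast hA
      _ ≤ _ := card_le_height_varIdeal (k := k) A
      _ ≤ _ := Ideal.height_mono (by
        rw [Ideal.span_le]
        rintro _ ⟨v, hv, rfl⟩
        simpa [hAdef] using hv)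
end

section
/- Let r be a positive natural number, let R' be a commutative ring graded by ℤ^r, and let R ⊆ R' be a graded subring (a subring that is the sum of its intersections with the graded pieces of R') such that R' is integral over R. Fix χ ∈ ℤ^r. Let J be the ideal of R' generated by all homogeneous elements of R whose degree equals nχ for some integer n ≥ 1, and let J' be the ideal of R' generated by all homogeneous elements of R' whose degree equals nχ for some integer n ≥ 1. Then the radicals of J and J' coincide: √J = √J'. -/
/-- Let `R'` be a commutative ring graded by `ℤ^r` (`r > 0`) via `𝒜`, and let `R ⊆ R'` be a
graded subring (i.e. the homogeneous components of its elements lie in it) over which `R'`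
is integral. Fix a character `χ ∈ ℤ^r`. Let `J` be the ideal of `R'` generated by all
homogeneous elements of `R` of degree `nχ` for some integer `n ≥ 1`, and `J'` the ideal of
`R'` generated by all homogeneous elements of `R'` of degree `nχ` for some `n ≥ 1`.
Then `√J = √J'`. -/
theorem stmt_9 {r : ℕ} (hr : 0 < r) {R' : Type*} [CommRing R']
    (𝒜 : (Fin r → ℤ) → AddSubgroup R') [GradedRing 𝒜]
    (R : Subring R')
    (hgraded : ∀ x ∈ R, ∀ d : Fin r → ℤ, ((DirectSum.decompose 𝒜 x d : 𝒜 d) : R') ∈ R)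
    (hint : Algebra.IsIntegral R R')
    (χ : Fin r → ℤ) :
    (Ideal.span {x : R' | x ∈ R ∧ ∃ n : ℕ, 1 ≤ n ∧ x ∈ 𝒜 (n • χ)}).radical =
      (Ideal.span {x : R' | ∃ n : ℕ, 1 ≤ n ∧ x ∈ 𝒜 (n • χ)}).radical := by
  apply le_antisymm
  · apply Ideal.radical_mono
    apply Ideal.span_mono
    rintro x ⟨_, h⟩
    exact h
  · rw [Ideal.radical_le_radical_iff, Ideal.span_le]
    rintro x ⟨n, hn, hx⟩
    obtain ⟨p, hp, hpx⟩ := hint.isIntegral x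
    refine ⟨p.natDegree, ?_⟩
    set J := Ideal.span {x : R' | x ∈ R ∧ ∃ n : ℕ, 1 ≤ n ∧ x ∈ 𝒜 (n • χ)} with hJ
    rw [Polynomial.eval₂_eq_sum_range, Finset.sum_range_succ, hp.coeff_natDegree, map_one,
      one_mul] at hpx
    have h := congrArg (GradedRing.proj 𝒜 (p.natDegree • (n • χ))) hpx
    rw [map_add, map_zero, map_sum, GradedRing.proj_apply 𝒜 _ (x ^ _),
      DirectSum.decompose_of_mem_same 𝒜 (SetLike.pow_mem_graded _ hx)] at h
    rw [eq_neg_of_add_eq_zero_right h]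
    refine J.neg_mem (J.sum_mem fun i hi => ?_)
    have hi' : i < p.natDegree := Finset.mem_range.mp hi
    have hd : p.natDegree • (n • χ) = ((p.natDegree - i) * n) • χ + i • (n • χ) := by
      rw [mul_smul, ← add_smul, Nat.sub_add_cancel hi'.le]
    rw [GradedRing.proj_apply, hd,
      DirectSum.coe_decompose_mul_add_of_right_mem 𝒜 (SetLike.pow_mem_graded i hx)]
    refine J.mul_mem_right _ (Ideal.subset_span ⟨hgraded _ (p.coeff i).2 _, _, ?_,
      SetLike.coe_mem _⟩)
    exact Nat.mul_pos (Nat.sub_pos_of_lt hi') hn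
end
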